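/- Let k ≥ 1, r ≥ 2, and let E₁, …, E_{r−1} be real k×k matrices satisfying E_iᵗE_i = 1ₖ for all i and E_iᵗE_j + E_jᵗE_i = 0 for all i ≠ j. Define the 2k×2k block matrices A_i = [[0, E_i], [E_iᵗ, 0]] for 1 ≤ i ≤ r−1 and A_r = [[1ₖ, 0], [0, −1ₖ]]. Then each A_i (1 ≤ i ≤ r) is symmetric, satisfies A_i² = 1_{2k}, and A_iA_j + A_jA_i = 0 for all i ≠ j. -/

import Mathlib

open Matrix

/-- Two orthogonal matrices with `Pᵗ Q + Qᵗ P = 0` also satisfy `P Qᵗ + Q Pᵗ = 0`. -/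
theorem Matrix.mul_transpose_add_mul_transpose_eq_zero {n R : Type*} [Fintype n] [DecidableEq n]
    [CommRing R] {P Q : Matrix n n R} (hP : Pᵀ * P = 1)
    (h : Pᵀ * Q + Qᵀ * P = 0) : P * Qᵀ + Q * Pᵀ = 0 := by
  have hP' : P * Pᵀ = 1 := mul_eq_one_comm.mp hP
  calc P * Qᵀ + Q * Pᵀ = P * Qᵀ * (P * Pᵀ) + P * Pᵀ * Q * Pᵀ := by simp [hP']
    _ = P * (Pᵀ * Q + Qᵀ * P) * Pᵀ := by noncomm_ring
    _ = 0 := by simp [h]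

/-- Given `k ≥ 1`, `r ≥ 2`, and real `k × k` matrices `E₁, …, E_{r−1}` with
`E_iᵗE_i = 1ₖ` and `E_iᵗE_j + E_jᵗE_i = 0` for `i ≠ j`, the `2k × 2k` block
matrices `A_i = [[0, E_i], [E_iᵗ, 0]]` (`1 ≤ i ≤ r−1`) together with
`A_r = [[1ₖ, 0], [0, −1ₖ]]` are symmetric, square to the identity, and pairwise
anticommute. -/
theorem block_construction_symmetric_hurwitz (k r : ℕ) (hk : 1 ≤ k) (hr : 2 ≤ r)
    (E : Fin (r - 1) → Matrix (Fin k) (Fin k) ℝ)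
    (hE1 : ∀ i, (E i)ᵀ * E i = 1)
    (hE2 : ∀ i j, i ≠ j → (E i)ᵀ * E j + (E j)ᵀ * E i = 0)
    (A : Fin r → Matrix (Fin k ⊕ Fin k) (Fin k ⊕ Fin k) ℝ)
    (hA : ∀ i : Fin r, A i = if h : i.1 < r - 1
      then Matrix.fromBlocks 0 (E ⟨i.1, h⟩) (E ⟨i.1, h⟩)ᵀ 0
      else Matrix.fromBlocks 1 0 0 (-1)) :
    (∀ i, (A i).IsSymm) ∧ (∀ i, A i * A i = 1) ∧
      (∀ i j, i ≠ j → A i * A j + A j * A i = 0) := by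
  refine ⟨fun i => ?_, fun i => ?_, fun i j hij => ?_⟩
  · rw [hA]
    split_ifs <;> simp [IsSymm, fromBlocks_transpose]
  · rw [hA]
    split_ifs with h
    · simp [fromBlocks_multiply, hE1, mul_eq_one_comm.mp (hE1 _)]
    · simp [fromBlocks_multiply]
  · rw [hA i, hA j]
    split_ifs with hi hj hj
    · have hne : (⟨i.1, hi⟩ : Fin (r - 1)) ≠ ⟨j.1, hj⟩ := by
        simpa [Fin.ext_iff] using hij
      simp [fromBlocks_multiply, fromBlocks_add, hE2 _ _ hne,
        mul_transpose_add_mul_transpose_eq_zero (hE1 _) (hE2 _ _ hne)]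
    · simp [fromBlocks_multiply, fromBlocks_add]
    · simp [fromBlocks_multiply, fromBlocks_add]
    · exact absurd (Fin.ext (by omega)) hij
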